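/- Kolmogorov superposition theorem: for every d ≥ 2 there exist continuous functions θ_{q,p} : [0,1] → ℝ, for q = 0, …, 2d and p = 1, …, d, independent of the target function, such that for every continuous function f : [0,1]^d → ℝ there exist continuous functions Ψ_q : ℝ → ℝ (depending on f) with f(x_1, …, x_d) = Σ_{q=0}^{2d} Ψ_q( Σ_{p=1}^{d} θ_{q,p}(x_p) ) for all (x_1, …, x_d) ∈ [0,1]^d. -/

import Mathlib

open Real

/-- Finitely many families of reals can be perturbed so that the sums of one entry from each family
are pairwise distinct. -/
theorem exists_dist_le_injective_sum {d M : ℕ} (a : Fin d → Fin M → ℝ) {ε : ℝ} (hε : 0 < ε) :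
    ∃ c : Fin d → Fin M → ℝ, (∀ p j, |c p j - a p j| ≤ ε) ∧
      Function.Injective fun j : Fin d → Fin M => ∑ p, c p (j p) := by
  rcases Nat.eq_zero_or_pos M with rfl | hM
  · exact ⟨a, fun p j => j.elim0, fun i j _ => funext fun p => (i p).elim0⟩
  have hMd : (0 : ℝ) < (M : ℝ) ^ d := by positivity
  have hlt (p : Fin d) (j : Fin M) : (j : ℝ) * M ^ (p : ℕ) < M ^ d := by
    have h1 : (j : ℕ) * M ^ (p : ℕ) < M ^ d :=
      calc (j : ℕ) * M ^ (p : ℕ) < M * M ^ (p : ℕ) := by gcongr; exact j.2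
        _ = M ^ ((p : ℕ) + 1) := by ring
        _ ≤ M ^ d := Nat.pow_le_pow_right hM p.2
    exact_mod_cast h1
  refine ⟨fun p j => ε * (⌊a p j / ε⌋ + (j : ℝ) * M ^ (p : ℕ) / M ^ d), fun p j => ?_,
    fun i j hij => ?_⟩
  · have h1 := Int.floor_le (a p j / ε)
    have h2 := Int.lt_floor_add_one (a p j / ε)
    have h3 : (j : ℝ) * M ^ (p : ℕ) / M ^ d < 1 := (div_lt_one hMd).2 (hlt p j)
    have h4 : 0 ≤ (j : ℝ) * M ^ (p : ℕ) / M ^ d := by positivity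
    have h5 : ε * (a p j / ε) = a p j := by field_simp
    rw [abs_le]
    constructor <;> nlinarith
  · have key : ∀ i : Fin d → Fin M,
        ∑ p, ε * (⌊a p (i p) / ε⌋ + ((i p : ℕ) : ℝ) * M ^ (p : ℕ) / M ^ d) =
          ε / M ^ d * (((∑ p, ⌊a p (i p) / ε⌋) * (M ^ d : ℕ) + (finFunctionFinEquiv i : ℕ) : ℤ)
            : ℝ) := by
      intro i
      rw [finFunctionFinEquiv_apply, ← Finset.mul_sum, Finset.sum_add_distrib, ← Finset.sum_div]
      push_cast
      field_simp
    simp only [key] at hij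
    have h1 := mul_left_cancel₀ (by positivity) hij
    have h2 := Int.cast_injective h1
    have h3 := congrArg (· % ((M ^ d : ℕ) : ℤ)) h2
    simp only [add_comm _ ((_ : ℕ) : ℤ), Int.add_mul_emod_self_right] at h3
    norm_cast at h3
    rw [Nat.mod_eq_of_lt (finFunctionFinEquiv i).2, Nat.mod_eq_of_lt (finFunctionFinEquiv j).2] at h3
    exact finFunctionFinEquiv.injective (Fin.ext h3)

/-- The unit interval carries `n` closed subsets, each a finite disjoint union of small pieces, such
that every point belongs to all but at most one of them. -/
theorem exists_closed_pieces (n : ℕ) {η : ℝ} (hη : 0 < η) :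
    ∃ (M : ℕ) (G : Fin n → Set (Set.Icc (0 : ℝ) 1)) (j : Fin n → Set.Icc (0 : ℝ) 1 → Fin M),
      (∀ q, IsClosed (G q)) ∧ (∀ q, ContinuousOn (j q) (G q)) ∧
      (∀ q t t', j q t = j q t' → dist t t' < η) ∧
      ∀ t q q', t ∉ G q → t ∉ G q' → q = q' := by
  rcases Nat.eq_zero_or_pos n with rfl | hn
  · exact ⟨1, fun _ => ∅, fun _ _ => 0, fun q => q.elim0, fun q => q.elim0, fun q => q.elim0,
      fun _ q => q.elim0⟩
  have hn' : (0 : ℝ) < n := by exact_mod_cast hn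
  obtain ⟨N, hN⟩ := exists_nat_gt (1 / η)
  have hN0 : (0 : ℝ) < N := lt_trans (by positivity) hN
  let s : Fin n → Set.Icc (0 : ℝ) 1 → ℝ := fun q t => N * t + 1 - q / n
  have hs0 (q t) : 0 < s q t := by
    have h1 : ((q : ℕ) : ℝ) / n < 1 := (div_lt_one hn').2 (by exact_mod_cast q.2)
    have h2 : 0 ≤ (N : ℝ) * t := mul_nonneg hN0.le t.2.1
    simp only [s]; linarith
  have hs1 (q t) : s q t < (N + 2 : ℕ) := by
    have h1 : 0 ≤ ((q : ℕ) : ℝ) / n := by positivity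
    have h2 : (N : ℝ) * t ≤ N := mul_le_of_le_one_right hN0.le t.2.2
    simp only [s]; push_cast; linarith
  have hsc (q) : Continuous (s q) := by fun_prop
  refine ⟨N + 2, fun q => {t | ∀ k : ℤ, 1 / (2 * n) ≤ |s q t - k|},
    fun q t => ⟨⌊s q t⌋₊, (Nat.floor_lt (hs0 q t).le).2 (hs1 q t)⟩, fun q => ?_, fun q => ?_,
    fun q t t' h => ?_, fun t q q' h h' => ?_⟩
  · simp only [Set.ofPred_forall]
    exact isClosed_iInter fun k => isClosed_le continuous_const (by fun_prop)
  · intro t ht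
    refine ContinuousAt.continuousWithinAt ?_
    have h1 : (⌊s q t⌋₊ : ℝ) < s q t := by
      refine lt_of_le_of_ne (Nat.floor_le (hs0 q t).le) fun h => ?_
      have h2 := ht ⌊s q t⌋₊
      rw [Int.cast_natCast, h, sub_self, abs_zero] at h2
      have : (0 : ℝ) < 1 / (2 * n) := by positivity
      linarith
    have h2 : ∀ᶠ t' in nhds t, s q t' ∈ Set.Ioo (⌊s q t⌋₊ : ℝ) (⌊s q t⌋₊ + 1) :=
      (hsc q).continuousAt.eventually (Ioo_mem_nhds h1 (Nat.lt_floor_add_one _))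
    refine continuousAt_const.congr (f := fun _ =>
      (⟨⌊s q t⌋₊, (Nat.floor_lt (hs0 q t).le).2 (hs1 q t)⟩ : Fin (N + 2))) ?_
    filter_upwards [h2] with t' ht'
    exact Fin.ext ((Nat.floor_eq_iff (hs0 q t').le).2 ⟨ht'.1.le, ht'.2⟩).symm
  · have h0 : ⌊s q t⌋₊ = ⌊s q t'⌋₊ := congrArg Fin.val h
    have h1 := Nat.floor_le (hs0 q t).le
    have h2 := Nat.lt_floor_add_one (s q t)
    have h3 := Nat.floor_le (hs0 q t').le
    have h4 := Nat.lt_floor_add_one (s q t')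
    rw [h0] at h1 h2
    rw [div_lt_iff₀ hη] at hN
    rw [Subtype.dist_eq, Real.dist_eq]
    have h5 : (N : ℝ) * |(t : ℝ) - t'| < 1 := by
      rw [← abs_of_pos hN0, ← abs_mul, abs_lt]
      simp only [s] at h1 h2 h3 h4
      constructor <;> linarith
    exact lt_of_mul_lt_mul_left (h5.trans hN) hN0.le
  · simp only [Set.mem_ofPred_eq, not_forall, not_le] at h h'
    obtain ⟨k, hk⟩ := h
    obtain ⟨k', hk'⟩ := h'
    have h1 : |(((q : ℕ) : ℝ) - q') + n * (k - k')| < 1 := by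
      have h2 : |(s q' t - k') - (s q t - k)| < 1 / n := by
        calc _ ≤ |s q' t - k'| + |s q t - k| := abs_sub _ _
          _ < 1 / (2 * n) + 1 / (2 * n) := add_lt_add hk' hk
          _ = 1 / n := by field_simp; norm_num
      have h3 : (((q : ℕ) : ℝ) - q') + n * (k - k') = n * ((s q' t - k') - (s q t - k)) := by
        simp only [s]; field_simp; ring
      rw [h3, abs_mul, abs_of_pos hn']
      calc _ < (n : ℝ) * (1 / n) := by gcongr
        _ = 1 := by field_simp
    have h2 : |((q : ℕ) : ℤ) - (q' : ℕ) + (n : ℤ) * (k - k')| < 1 := by exact_mod_cast h1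
    rw [Int.abs_lt_one_iff] at h2
    have h3 : ((q : ℕ) : ℤ) ≡ (q' : ℕ) [ZMOD n] :=
      (Int.modEq_iff_dvd.2 ⟨k - k', by linarith⟩)
    rw [Int.natCast_modEq_iff] at h3
    exact Fin.ext (h3.eq_of_lt_of_lt q.2 q'.2)

/-- A bounded operator on a complete space whose range approximates every vector up to a fixed
proportion, with controlled preimages, is surjective. -/
theorem ContinuousLinearMap.surjective_of_approx {E F : Type*} [NormedAddCommGroup E]
    [NormedSpace ℝ E] [CompleteSpace E] [NormedAddCommGroup F] [NormedSpace ℝ F]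
    (T : E →L[ℝ] F) {C ρ : ℝ} (hρ0 : 0 ≤ ρ) (hρ : ρ < 1)
    (h : ∀ y, ∃ x, ‖x‖ ≤ C * ‖y‖ ∧ ‖y - T x‖ ≤ ρ * ‖y‖) : Function.Surjective T := by
  intro y
  choose g hg hgT using h
  let r : ℕ → F := fun n => (fun z => z - T (g z))^[n] y
  have hr_succ (n) : r (n + 1) = r n - T (g (r n)) := Function.iterate_succ_apply' _ _ _
  have hr (n) : ‖r n‖ ≤ ρ ^ n * ‖y‖ := by
    induction n with
    | zero => simp [r]
    | succ n ih =>
      rw [hr_succ, pow_succ', mul_assoc]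
      exact (hgT _).trans (by gcongr)
  have hC : ∀ n, ‖g (r n)‖ ≤ |C| * ‖y‖ * ρ ^ n := fun n =>
    calc _ ≤ C * ‖r n‖ := hg _
      _ ≤ |C| * (ρ ^ n * ‖y‖) := by gcongr; exacts [le_abs_self C, hr n]
      _ = _ := by ring
  have hsum : Summable fun n => g (r n) :=
    Summable.of_norm_bounded ((summable_geometric_of_lt_one hρ0 hρ).mul_left _) hC
  refine ⟨∑' n, g (r n), ?_⟩
  have h1 := (hsum.hasSum.mapL T).tendsto_sum_nat
  have h2 (n) : ∑ i ∈ Finset.range n, T (g (r i)) = y - r n := by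
    induction n with
    | zero => simp [r]
    | succ n ih => rw [Finset.sum_range_succ, ih, hr_succ]; abel
  have h3 : Filter.Tendsto r Filter.atTop (nhds 0) := by
    refine squeeze_zero_norm hr ?_
    simpa using (tendsto_pow_atTop_nhds_zero_of_lt_one hρ0 hρ).mul_const ‖y‖
  simp only [h2] at h1
  exact tendsto_nhds_unique h1 (by simpa using tendsto_const_nhds.sub h3)

open scoped BoundedContinuousFunction

/-- The superposition `x ↦ ∑ q, g q (∑ p, θ q p (x p))`. -/
def superposition {n d : ℕ} (θ : Fin n → Fin d → C(Set.Icc (0 : ℝ) 1, ℝ)) (g : Fin n → ℝ →ᵇ ℝ) :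
    C(Fin d → Set.Icc (0 : ℝ) 1, ℝ) :=
  ∑ q, (g q).toContinuousMap.comp (∑ p, (θ q p).comp (ContinuousMap.eval p))

theorem superposition_apply {n d : ℕ} (θ : Fin n → Fin d → C(Set.Icc (0 : ℝ) 1, ℝ))
    (g : Fin n → ℝ →ᵇ ℝ) (x : Fin d → Set.Icc (0 : ℝ) 1) :
    superposition θ g x = ∑ q, g q (∑ p, θ q p (x p)) := by
  simp [superposition, ContinuousMap.sum_apply]

theorem continuous_superposition {n d : ℕ} (g : Fin n → ℝ →ᵇ ℝ) :
    Continuous fun θ : Fin n → Fin d → C(Set.Icc (0 : ℝ) 1, ℝ) => superposition θ g := by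
  refine continuous_finsetSum _ fun q _ => (ContinuousMap.continuous_postcomp _).comp ?_
  exact continuous_finsetSum _ fun p _ => (ContinuousMap.continuous_precomp _).comp
    ((continuous_apply p).comp (continuous_apply q))

/-- For fixed inner functions, the superposition as a bounded operator in the outer functions. -/
noncomputable def superpositionCLM {n d : ℕ} (θ : Fin n → Fin d → C(Set.Icc (0 : ℝ) 1, ℝ)) :
    (Fin n → ℝ →ᵇ ℝ) →L[ℝ] C(Fin d → Set.Icc (0 : ℝ) 1, ℝ) :=
  LinearMap.mkContinuous
    { toFun := superposition θ
      map_add' := fun g h => by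
        ext x; simp [superposition_apply, Finset.sum_add_distrib]
      map_smul' := fun c g => by
        ext x; simp [superposition_apply, Finset.mul_sum] } n fun g => by
    refine (ContinuousMap.norm_le _ (by positivity)).2 fun x => ?_
    simp only [LinearMap.coe_mk, AddHom.coe_mk, superposition_apply]
    calc _ ≤ ∑ q, ‖g q (∑ p, θ q p (x p))‖ := norm_sum_le _ _
      _ ≤ ∑ _q : Fin n, ‖g‖ :=
        Finset.sum_le_sum fun q _ => ((g q).norm_coe_le_norm _).trans (norm_le_pi_norm g q)
      _ = n * ‖g‖ := by simp

/-- The inner functions for which `f` is approximated by a superposition with outer functions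
bounded by `‖f‖`, up to a proportion `d / (d + 1)` of its norm and an error `δ`. -/
def approximatingSet {d : ℕ} (f : C(Fin d → Set.Icc (0 : ℝ) 1, ℝ)) (δ : ℝ) :
    Set (Fin (2 * d + 1) → Fin d → C(Set.Icc (0 : ℝ) 1, ℝ)) :=
  {θ | ∃ g : Fin (2 * d + 1) → ℝ →ᵇ ℝ,
    ‖g‖ ≤ ‖f‖ ∧ ‖f - superposition θ g‖ < d / (d + 1) * ‖f‖ + δ}

theorem isOpen_approximatingSet {d : ℕ} (f : C(Fin d → Set.Icc (0 : ℝ) 1, ℝ)) (δ : ℝ) :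
    IsOpen (approximatingSet f δ) := by
  have : approximatingSet f δ = ⋃ (g : Fin (2 * d + 1) → ℝ →ᵇ ℝ) (_ : ‖g‖ ≤ ‖f‖),
      {θ | ‖f - superposition θ g‖ < d / (d + 1) * ‖f‖ + δ} := by
    ext θ; simp [approximatingSet]
  rw [this]
  exact isOpen_iUnion fun g => isOpen_iUnion fun _ =>
    isOpen_lt (continuous_const.sub (continuous_superposition g)).norm continuous_const

/-- A continuous function on a closed subset that stays within `ε` of a continuous function on the
whole space extends to a continuous function that stays within `ε` of it. -/
theorem ContinuousMap.exists_dist_le_eqOn {X : Type*} [TopologicalSpace X] [CompactSpace X]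
    [NormalSpace X] {G : Set X} (hG : IsClosed G) (u : C(X, ℝ)) {v : X → ℝ}
    (hv : ContinuousOn v G) {ε : ℝ} (hε : 0 ≤ ε) (h : ∀ t ∈ G, |v t - u t| ≤ ε) :
    ∃ w : C(X, ℝ), dist w u ≤ ε ∧ Set.EqOn w v G := by
  have hc : Continuous fun t : G => v t - u t :=
    hv.domRestrict.sub (u.continuous.comp continuous_subtype_val)
  obtain ⟨k, hk, hkG⟩ := BoundedContinuousFunction.exists_norm_eq_domRestrict_eq_of_closed
    (BoundedContinuousFunction.ofNormedAddCommGroup _ hc ε fun t => h t t.2) hG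
  refine ⟨u + k.toContinuousMap, (ContinuousMap.dist_le hε).2 fun t => ?_, fun t ht => ?_⟩
  · have := (k.norm_coe_le_norm t).trans (hk.le.trans
      (BoundedContinuousFunction.norm_ofNormedAddCommGroup_le hc hε _))
    simpa [Real.dist_eq] using this
  · have := DFunLike.congr_fun hkG ⟨t, ht⟩
    simp only [BoundedContinuousFunction.domRestrict_apply,
      BoundedContinuousFunction.coe_ofNormedAddCommGroup] at this
    simp [this]

/-- Real values prescribed at finitely many distinct reals are interpolated by a bounded continuous
function with the same bound. -/
theorem exists_boundedContinuousFunction_interpolating {J : Type*} [Finite J] {s : J → ℝ}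
    (hs : Function.Injective s) (v : J → ℝ) {C : ℝ} (hC : 0 ≤ C) (hv : ∀ j, |v j| ≤ C) :
    ∃ g : ℝ →ᵇ ℝ, ‖g‖ ≤ C ∧ ∀ j, g (s j) = v j := by
  let _ : TopologicalSpace J := ⊥
  have : DiscreteTopology J := ⟨rfl⟩
  obtain ⟨g, hg, hgs⟩ := BoundedContinuousFunction.exists_extension_norm_eq_of_isClosedEmbedding
    (BoundedContinuousFunction.ofNormedAddCommGroup v continuous_of_discreteTopology C hv)
    (continuous_of_discreteTopology.isClosedEmbedding hs)
  exact ⟨g, hg.le.trans (BoundedContinuousFunction.norm_ofNormedAddCommGroup_le _ hC _),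
    fun j => congrFun hgs j⟩

theorem dense_approximatingSet {d : ℕ} (f : C(Fin d → Set.Icc (0 : ℝ) 1, ℝ)) {δ : ℝ}
    (hδ : 0 < δ) : Dense (approximatingSet f δ) := by
  refine Metric.dense_iff.2 fun θ ε hε => ?_
  obtain ⟨η₁, hη₁, hf⟩ := Metric.uniformContinuous_iff.1
    (CompactSpace.uniformContinuous_of_continuous f.continuous) (δ / 2) (by positivity)
  have hθc : Continuous fun t => fun q p => θ q p t := by fun_prop
  obtain ⟨η₂, hη₂, hθ⟩ := Metric.uniformContinuous_iff.1
    (CompactSpace.uniformContinuous_of_continuous hθc) (ε / 4) (by positivity)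
  obtain ⟨M, G, j, hG, hj, hdist, hbad⟩ := exists_closed_pieces (2 * d + 1) (lt_min hη₁ hη₂)
  let r : Fin (2 * d + 1) → Fin M → Set.Icc (0 : ℝ) 1 := fun q => Function.invFun (j q)
  have hr (q t) : dist t (r q (j q t)) < min η₁ η₂ :=
    hdist q _ _ (Function.invFun_eq (f := j q) ⟨t, rfl⟩).symm
  choose c hc hcinj using fun q =>
    exists_dist_le_injective_sum (fun p i => θ q p (r q i)) (show 0 < ε / 4 by positivity)
  have hclose (q p t) : |c q p (j q t) - θ q p t| ≤ ε / 2 := by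
    have h1 := hc q p (j q t)
    have h2 := hθ ((hr q t).trans_le (min_le_right _ _))
    have h3 : dist (θ q p t) (θ q p (r q (j q t))) ≤ ε / 4 :=
      (dist_le_pi_dist (fun p => θ q p t) (fun p => θ q p (r q (j q t))) p).trans
        ((dist_le_pi_dist (fun q p => θ q p t) (fun q' p => θ q' p (r q (j q t))) q).trans h2.le)
    rw [Real.dist_eq, abs_sub_comm] at h3
    calc _ ≤ |c q p (j q t) - θ q p (r q (j q t))| + |θ q p (r q (j q t)) - θ q p t| :=
          abs_sub_le _ _ _
      _ ≤ ε / 2 := by linarith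
  choose θ' hθ' hθG using fun q p => ContinuousMap.exists_dist_le_eqOn (hG q) (θ q p)
    ((continuous_of_discreteTopology (f := c q p)).comp_continuousOn (hj q))
    (by positivity : 0 ≤ ε / 2) fun t _ => hclose q p t
  choose g hg hgc using fun q => exists_boundedContinuousFunction_interpolating (hcinj q)
    (fun i => f (fun p => r q (i p)) / (d + 1)) (C := ‖f‖ / (d + 1)) (by positivity) fun i => by
      rw [abs_div, abs_of_pos (by positivity : (0 : ℝ) < d + 1)]
      gcongr
      exact f.norm_coe_le_norm _
  refine ⟨θ', ?_, g, ?_, ?_⟩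
  · refine lt_of_le_of_lt (b := ε / 2) ?_ (by linarith)
    exact (dist_pi_le_iff (by positivity)).2 fun q => (dist_pi_le_iff (by positivity)).2 (hθ' q)
  · refine (pi_norm_le_iff_of_nonneg (norm_nonneg _)).2 fun q => (hg q).trans ?_
    exact div_le_self (norm_nonneg _) (by linarith [(Nat.cast_nonneg d : (0 : ℝ) ≤ d)])
  refine lt_of_le_of_lt (b := d / (d + 1) * ‖f‖ + δ / 2) ?_ (by linarith)
  refine (ContinuousMap.norm_le _ (by positivity)).2 fun x => ?_
  rw [ContinuousMap.sub_apply, superposition_apply]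
  classical
  have hcard : d + 1 ≤ (Finset.univ.filter fun q => ∀ p, x p ∈ G q).card := by
    have h1 : (Finset.univ.filter fun q => ¬ ∀ p, x p ∈ G q).card ≤ d := by
      have h2 : ∀ q : {q // ¬ ∀ p, x p ∈ G q}, ∃ p, x p ∉ G q := fun q => not_forall.1 q.2
      choose b hb using h2
      have h3 := Fintype.card_le_of_injective b fun q q' h =>
        Subtype.ext (hbad _ _ _ (hb q) (h ▸ hb q'))
      rwa [Fintype.card_fin, Fintype.card_subtype] at h3
    have h2 := Finset.card_filter_add_card_filter_not (s := Finset.univ)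
      (fun q : Fin (2 * d + 1) => ∀ p, x p ∈ G q)
    rw [Finset.card_univ, Fintype.card_fin] at h2
    omega
  obtain ⟨B, hBsub, hB⟩ := Finset.exists_subset_card_eq hcard
  have hBc : Bᶜ.card = d := by rw [Finset.card_compl, hB, Fintype.card_fin]; omega
  have hgood : ∀ q ∈ B, ‖f x / (d + 1) - g q (∑ p, θ' q p (x p))‖ ≤ δ / 2 / (d + 1) := by
    intro q hq
    have hxG := (Finset.mem_filter.1 (hBsub hq)).2
    have h1 : ∑ p, θ' q p (x p) = ∑ p, c q p (j q (x p)) :=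
      Finset.sum_congr rfl fun p _ => hθG q p (hxG p)
    rw [h1, hgc q fun p => j q (x p), ← sub_div, norm_div,
      Real.norm_of_nonneg (by positivity : (0 : ℝ) ≤ d + 1)]
    gcongr
    rw [← dist_eq_norm]
    exact (hf ((dist_pi_lt_iff hη₁).2 fun p => (hr q (x p)).trans_le (min_le_left _ _))).le
  have hsplit : f x - ∑ q, g q (∑ p, θ' q p (x p)) =
      ∑ q ∈ B, (f x / (d + 1) - g q (∑ p, θ' q p (x p))) -
        ∑ q ∈ Bᶜ, g q (∑ p, θ' q p (x p)) := by
    rw [Finset.sum_sub_distrib, Finset.sum_const, hB, ← Finset.sum_add_sum_compl B, nsmul_eq_mul]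
    push_cast
    field_simp
    ring
  rw [hsplit]
  calc _ ≤ ‖∑ q ∈ B, (f x / (d + 1) - g q (∑ p, θ' q p (x p)))‖ +
        ‖∑ q ∈ Bᶜ, g q (∑ p, θ' q p (x p))‖ := norm_sub_le _ _
    _ ≤ ∑ _q ∈ B, δ / 2 / (d + 1) + ∑ _q ∈ Bᶜ, ‖f‖ / (d + 1) :=
      add_le_add (norm_sum_le_of_le _ hgood)
        (norm_sum_le_of_le _ fun q _ => ((g q).norm_coe_le_norm _).trans (hg q))
    _ = d / (d + 1) * ‖f‖ + δ / 2 := by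
      rw [Finset.sum_const, Finset.sum_const, hB, hBc, nsmul_eq_mul, nsmul_eq_mul]
      push_cast
      field_simp
      ring

/-- There are inner functions lying in the approximating sets of all target functions. -/
theorem exists_forall_approx (d : ℕ) :
    ∃ θ : Fin (2 * d + 1) → Fin d → C(Set.Icc (0 : ℝ) 1, ℝ),
      ∀ (f : C(Fin d → Set.Icc (0 : ℝ) 1, ℝ)) (δ : ℝ), 0 < δ →
        ∃ g : Fin (2 * d + 1) → ℝ →ᵇ ℝ, ‖g‖ ≤ ‖f‖ + δ ∧
          ‖f - superposition θ g‖ ≤ d / (d + 1) * ‖f‖ + δ := by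
  let D := TopologicalSpace.denseSeq C(Fin d → Set.Icc (0 : ℝ) 1, ℝ)
  have : BaireSpace (Fin (2 * d + 1) → Fin d → C(Set.Icc (0 : ℝ) 1, ℝ)) :=
    BaireSpace.of_completelyPseudoMetrizable
  obtain ⟨θ, hθ⟩ := (dense_iInter_of_isOpen
    (f := fun i : ℕ × ℕ => approximatingSet (D i.1) (1 / ((i.2 : ℝ) + 1)))
    (fun i => isOpen_approximatingSet _ _)
    fun i => dense_approximatingSet _ Nat.one_div_pos_of_nat).nonempty
  rw [Set.mem_iInter] at hθ
  refine ⟨θ, fun f δ hδ => ?_⟩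
  obtain ⟨m, hm⟩ := exists_nat_one_div_lt (show 0 < δ / 3 by positivity)
  obtain ⟨n, hn⟩ := Metric.denseRange_iff.1 (TopologicalSpace.denseRange_denseSeq
    C(Fin d → Set.Icc (0 : ℝ) 1, ℝ)) f (δ / 3) (by positivity)
  obtain ⟨g, hg, hgD⟩ := hθ (n, m)
  change ‖g‖ ≤ ‖D n‖ at hg
  change ‖D n - _‖ < d / (d + 1) * ‖D n‖ + 1 / ((m : ℝ) + 1) at hgD
  change dist f (D n) < _ at hn
  rw [dist_eq_norm] at hn
  have h1 : ‖D n‖ ≤ ‖f‖ + δ / 3 := by linarith [norm_sub_norm_le (D n) f, norm_sub_rev f (D n)]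
  refine ⟨g, by linarith, ?_⟩
  have h2 : (d : ℝ) / (d + 1) ≤ 1 := (div_le_one (by positivity)).2 (by linarith)
  have h3 : (d : ℝ) / (d + 1) * ‖D n‖ ≤ d / (d + 1) * ‖f‖ + δ / 3 :=
    calc _ ≤ (d : ℝ) / (d + 1) * (‖f‖ + δ / 3) := by gcongr
      _ = d / (d + 1) * ‖f‖ + d / (d + 1) * (δ / 3) := by ring
      _ ≤ d / (d + 1) * ‖f‖ + 1 * (δ / 3) := by gcongr
      _ = _ := by ring
  linarith [norm_sub_le_norm_sub_add_norm_sub f (D n) (superposition θ g)]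

theorem kolmogorov_superposition
    (d : ℕ) (hd : 2 ≤ d) :
    ∃ θ : Fin (2 * d + 1) → Fin d → C(Set.Icc (0 : ℝ) 1, ℝ),
      ∀ f : C((Fin d → Set.Icc (0 : ℝ) 1), ℝ),
        ∃ Ψ : Fin (2 * d + 1) → C(ℝ, ℝ),
          ∀ x : Fin d → Set.Icc (0 : ℝ) 1,
            f x = ∑ q : Fin (2 * d + 1), Ψ q (∑ p : Fin d, θ q p (x p)) := by
  obtain ⟨θ, hθ⟩ := exists_forall_approx d
  refine ⟨θ, fun f => ?_⟩
  have hρ : (d : ℝ) / (d + 1) + 1 / (2 * (d + 1)) < 1 := by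
    rw [div_add_div _ _ (by positivity) (by positivity), div_lt_one (by positivity)]
    nlinarith [(Nat.cast_nonneg d : (0 : ℝ) ≤ d)]
  have hsurj : Function.Surjective (superpositionCLM θ) := by
    refine (superpositionCLM θ).surjective_of_approx (C := 1 + 1 / (2 * (d + 1)))
      (by positivity) hρ fun f => ?_
    rcases eq_or_ne f 0 with rfl | hf
    · exact ⟨0, by simp⟩
    have hf0 : 0 < ‖f‖ := norm_pos_iff.2 hf
    obtain ⟨g, hg, hfg⟩ := hθ f (1 / (2 * (d + 1)) * ‖f‖) (by positivity)
    refine ⟨g, by linarith, ?_⟩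
    change ‖f - superposition θ g‖ ≤ _
    linarith
  obtain ⟨g, hg⟩ := hsurj f
  refine ⟨fun q => (g q).toContinuousMap, fun x => ?_⟩
  rw [← hg]
  exact superposition_apply θ g x
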